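/- The 6-state 2-symbol Turing machine M with transition table δ(A,0)=(1,R,B), δ(A,1)=(0,L,B), δ(B,0)=(0,R,C), δ(B,1)=(1,L,B), δ(C,0)=(1,R,D), δ(C,1)=(0,L,A), δ(D,0)=(1,L,E), δ(D,1)=(1,L,F), δ(E,0)=(1,L,A), δ(E,1)=(0,L,D), δ(F,0)=(1,R,H), δ(F,1)=(1,L,E), started in state A on the all-blank tape, halts after exactly 2048·(4^1533 − 1)/3 − 11·2^1538 + 14,141,831 steps, leaving exactly 2·(2^1538 − 10)/3 + 4 non-blank cells on the final tape. -/

import Mathlib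

/-- Move direction of the tape head. -/
inductive Dir : Type
  | L
  | R

/-- The head displacement of a direction. -/
def Dir.move : Dir → ℤ
  | Dir.L => -1
  | Dir.R => 1

/-- A Turing machine with `n` states and `k` symbols, in Rado's busy beaver model.
States are `Fin n` (state `A` is `0`, `B` is `1`, ...), symbols are `Fin k` with `0`
the blank symbol. A transition yields the written symbol, the move direction and the
next state, where `none` denotes the halting state `H`. -/
abbrev Machine (n k : ℕ) : Type :=
  Fin n → Fin k → Fin k × Dir × Option (Fin n)

/-- A configuration: current state (`none` = halted), head position, tape. -/
structure Cfg (n k : ℕ) where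
  state : Option (Fin n)
  pos : ℤ
  tape : ℤ → Fin k

/-- One computation step (halted configurations are fixed). -/
def step {n k : ℕ} (M : Machine n k) (c : Cfg n k) : Cfg n k :=
  match c.state with
  | none => c
  | some q =>
      { state := (M q (c.tape c.pos)).2.2
        pos := c.pos + (M q (c.tape c.pos)).2.1.move
        tape := Function.update c.tape c.pos (M q (c.tape c.pos)).1 }

/-- The initial configuration: state `A`, head at cell `0`, all-blank tape. -/
def init (n k : ℕ) [NeZero k] : Cfg n k :=
  { state := if h : 0 < n then some ⟨0, h⟩ else none
    pos := 0
    tape := fun _ => 0 }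

/-- `HaltsIn M c t`: started from `c`, the machine `M` halts after exactly `t` steps. -/
def HaltsIn {n k : ℕ} (M : Machine n k) (c : Cfg n k) (t : ℕ) : Prop :=
  ((step M)^[t] c).state = none ∧ ∀ i < t, ((step M)^[i] c).state ≠ none

/-- The number of non-blank cells of a configuration. -/
noncomputable def sigmaCount {n k : ℕ} [NeZero k] (c : Cfg n k) : ℕ :=
  Set.ncard {i : ℤ | c.tape i ≠ 0}

/-- Marxen and Buntrock's second 6-state 2-symbol machine
(states `A,B,C,D,E,F` are `0,1,2,3,4,5`; `none` is the halting state `H`). -/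
def M : Machine 6 2 :=
  ![![(1, Dir.R, some 1), (0, Dir.L, some 1)],
    ![(0, Dir.R, some 2), (1, Dir.L, some 1)],
    ![(1, Dir.R, some 3), (0, Dir.L, some 0)],
    ![(1, Dir.L, some 4), (1, Dir.L, some 5)],
    ![(1, Dir.L, some 0), (0, Dir.L, some 3)],
    ![(1, Dir.R, none), (1, Dir.L, some 4)]]

/-- The configuration `C(n)` with head at cell `p`: state `B`, scanned cell blank,
the `n` cells immediately to the left of the head all contain `1`, all other cells blank. -/
def Cf (n : ℕ) (p : ℤ) : Cfg 6 2 :=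
  { state := some 1
    pos := p
    tape := fun i => if p - n ≤ i ∧ i < p then 1 else 0 }

open Turing

/-- A one-way infinite half of the tape, listed from the head outwards. -/
abbrev HalfTape : Type := ListBlank (Fin 2)

/-- The blank half-tape. -/
abbrev blank : HalfTape := default

/-- The configuration in state `q` with head at `p`, the half-tape `l` to the left of the head
and the half-tape `r` starting at the scanned cell. -/
def conf (q : Option (Fin 6)) (l r : HalfTape) (p : ℤ) : Cfg 6 2 :=
  ⟨q, p, fun i => (Tape.mk' l r).nth (i - p)⟩

/-- `Steps t q l r q' l' r'`: in `t` steps the machine `M` goes from state `q` with half-tapes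
`l`, `r` to state `q'` with half-tapes `l'`, `r'`, wherever the head starts. -/
def Steps (t : ℕ) (q : Option (Fin 6)) (l r : HalfTape)
    (q' : Option (Fin 6)) (l' r' : HalfTape) : Prop :=
  ∀ p, ∃ p', (step M)^[t] (conf q l r p) = conf q' l' r' p'

theorem Steps.refl (q : Option (Fin 6)) (l r : HalfTape) : Steps 0 q l r q l r :=
  fun p => ⟨p, rfl⟩

theorem Steps.trans {s t : ℕ} {q q' q'' : Option (Fin 6)} {l r l' r' l'' r'' : HalfTape}
    (h₁ : Steps s q l r q' l' r') (h₂ : Steps t q' l' r' q'' l'' r'') :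
    Steps (s + t) q l r q'' l'' r'' := by
  intro p
  obtain ⟨p₁, e₁⟩ := h₁ p
  obtain ⟨p₂, e₂⟩ := h₂ p₁
  exact ⟨p₂, by rw [add_comm, Function.iterate_add_apply, e₁, e₂]⟩

theorem Steps.cast {s t : ℕ} {q q' : Option (Fin 6)} {l r l' r' : HalfTape}
    (h : Steps s q l r q' l' r') (e : s = t) : Steps t q l r q' l' r' :=
  e ▸ h

theorem step_conf (q : Fin 6) (a : Fin 2) (l r : HalfTape) (p : ℤ) :
    step M (conf (some q) l (r.cons a) p) =
      ⟨(M q a).2.2, p + (M q a).2.1.move,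
        fun i => (Tape.mk' l (r.cons (M q a).1)).nth (i - p)⟩ := by
  have h : (conf (some q) l (r.cons a) p).tape p = a := by
    simp [conf, Tape.nth_zero]
  simp only [step, conf] at h ⊢
  rw [h]
  congr 1
  funext i
  have hw : Tape.mk' l (r.cons (M q a).1) = (Tape.mk' l (r.cons a)).write (M q a).1 := by simp
  rw [hw, Tape.write_nth]
  by_cases hi : i = p
  · simp [hi]
  · simp [hi, sub_eq_zero]

/-- A transition moving right, followed by further steps. -/
theorem Steps.right {t : ℕ} {q : Fin 6} {q' q'' : Option (Fin 6)} {a b : Fin 2}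
    {l r l' r' : HalfTape} (hM : M q a = (b, Dir.R, q'))
    (h : Steps t q' (l.cons b) r q'' l' r') : Steps (t + 1) (some q) l (r.cons a) q'' l' r' := by
  intro p
  obtain ⟨p', e⟩ := h (p + 1)
  refine ⟨p', ?_⟩
  rw [Function.iterate_succ_apply, step_conf, hM, ← e]
  congr 2
  funext i
  have := Tape.move_right_nth (Tape.mk' l (r.cons b)) (i - (p + 1))
  rw [Tape.move_right_mk', ListBlank.head_cons, ListBlank.tail_cons] at this
  rw [this]
  congr 1
  ring

/-- A transition moving left, followed by further steps. -/
theorem Steps.left {t : ℕ} {q : Fin 6} {q' q'' : Option (Fin 6)} {a b c : Fin 2}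
    {l r l' r' : HalfTape} (hM : M q a = (b, Dir.L, q'))
    (h : Steps t q' l ((r.cons b).cons c) q'' l' r') :
    Steps (t + 1) (some q) (l.cons c) (r.cons a) q'' l' r' := by
  intro p
  obtain ⟨p', e⟩ := h (p - 1)
  refine ⟨p', ?_⟩
  rw [Function.iterate_succ_apply, step_conf, hM, ← e]
  congr 2
  funext i
  have := Tape.move_left_nth (Tape.mk' (l.cons c) (r.cons b)) (i - (p - 1))
  rw [Tape.move_left_mk', ListBlank.head_cons, ListBlank.tail_cons] at this
  rw [this]
  congr 1
  ring

theorem cons_zero_blank : blank.cons 0 = blank :=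
  ListBlank.cons_head_tail blank

/-- A transition moving left into the blank part of the tape, followed by further steps. -/
theorem Steps.leftBlank {t : ℕ} {q : Fin 6} {q' q'' : Option (Fin 6)} {a b : Fin 2}
    {r l' r' : HalfTape} (hM : M q a = (b, Dir.L, q'))
    (h : Steps t q' blank ((r.cons b).cons 0) q'' l' r') :
    Steps (t + 1) (some q) blank (r.cons a) q'' l' r' := by
  have := Steps.left hM h
  rwa [cons_zero_blank] at this

/-- `n` ones in front of a half-tape. -/
def ones : ℕ → HalfTape → HalfTape
  | 0, x => x
  | n + 1, x => (ones n x).cons 1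

theorem ones_cons (n : ℕ) (x : HalfTape) : ones n (x.cons 1) = ones (n + 1) x := by
  induction n with
  | zero => rfl
  | succ n ih => rw [ones, ih]; rfl

/-- `k` blocks `011` in front of a half-tape. -/
def blocks : ℕ → HalfTape → HalfTape
  | 0, x => x
  | k + 1, x => (((blocks k x).cons 1).cons 1).cons 0

theorem blocks_cons (k : ℕ) (x : HalfTape) :
    blocks k (((x.cons 1).cons 1).cons 0) = blocks (k + 1) x := by
  induction k with
  | zero => rfl
  | succ k ih => rw [blocks, ih]; rfl

/-- `k` blocks `110` in front of a half-tape. -/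
def revBlocks : ℕ → HalfTape → HalfTape
  | 0, x => x
  | k + 1, x => (((revBlocks k x).cons 0).cons 1).cons 1

theorem revBlocks_cons (k : ℕ) (x : HalfTape) :
    revBlocks k (((x.cons 0).cons 1).cons 1) = revBlocks (k + 1) x := by
  induction k with
  | zero => rfl
  | succ k ih => rw [revBlocks, ih]; rfl

theorem cons_zero_revBlocks (k : ℕ) (x : HalfTape) :
    (revBlocks k x).cons 0 = blocks k (x.cons 0) := by
  induction k with
  | zero => rfl
  | succ k ih => rw [revBlocks, ih, blocks]

theorem sweep_right (a : ℕ) (l x : HalfTape) :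
    Steps (3 * a) (some 1) l ((ones a x).cons 0) (some 1) (ones a l) (x.cons 0) := by
  induction a generalizing l with
  | zero => exact Steps.refl _ _ _
  | succ a ih =>
    have h := ih (l.cons 1)
    rw [ones_cons] at h
    exact .right rfl (.left rfl (.right rfl h))

theorem sweep_left (a : ℕ) (x : HalfTape) :
    Steps (a + 1) (some 1) (ones a blank) (x.cons 1) (some 1) blank ((ones (a + 1) x).cons 0) := by
  induction a generalizing x with
  | zero => exact .leftBlank rfl (.refl _ _ _)
  | succ a ih =>
    have h := ih (x.cons 1)
    rw [ones_cons] at h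
    exact .left rfl h

theorem turn_left (a : ℕ) (x : HalfTape) :
    Steps (a + 1) (some 0) (ones a blank) (x.cons 1)
      (some 1) blank ((ones a (x.cons 0)).cons 0) := by
  cases a with
  | zero => exact .leftBlank rfl (.refl _ _ _)
  | succ a => exact .left rfl (sweep_left a (x.cons 0))

theorem shift_gap (a : ℕ) (x : HalfTape) :
    Steps (4 * a + 9) (some 1) blank ((ones (a + 1) ((x.cons 1).cons 0)).cons 0)
      (some 1) blank ((ones a ((((x.cons 1).cons 1).cons 1).cons 0)).cons 0) :=
  ((sweep_right (a + 1) blank ((x.cons 1).cons 0)).trans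
    (.right rfl (.right rfl (.left rfl (.left rfl (.left rfl (turn_left a _))))))).cast (by ring)

theorem close_gap (x : HalfTape) :
    Steps 8 (some 1) blank (((x.cons 1).cons 0).cons 0) (some 1) blank ((ones 4 x).cons 0) :=
  .right rfl (.right rfl (.left rfl (.left rfl (.leftBlank rfl
    (.right rfl (.left rfl (.leftBlank rfl (.refl _ _ _))))))))

/-- The leftmost run of ones swallows the gap to its right and the one after it. -/
theorem absorb (a : ℕ) (x : HalfTape) :
    Steps (2 * a ^ 2 + 7 * a + 8) (some 1) blank ((ones a ((x.cons 1).cons 0)).cons 0)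
      (some 1) blank ((ones (2 * a + 4) x).cons 0) := by
  induction a generalizing x with
  | zero => exact close_gap x
  | succ a ih =>
    have h := ih ((x.cons 1).cons 1)
    rw [ones_cons, ones_cons] at h
    exact ((shift_gap a x).trans h).cast (by ring)

theorem absorb_blocks (k a : ℕ) (x : HalfTape) :
    ∃ t b : ℕ, b + 5 = (a + 5) * 2 ^ k ∧
      (3 * t : ℤ) = 2 * (a + 5) ^ 2 * (4 ^ k - 1) - 39 * (a + 5) * (2 ^ k - 1) + 69 * k ∧
      Steps t (some 1) blank ((ones a (blocks k x)).cons 0)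
        (some 1) blank ((ones b x).cons 0) := by
  induction k generalizing a with
  | zero => exact ⟨0, a, by simp, by simp, .refl _ _ _⟩
  | succ k ih =>
    obtain ⟨t, b, hb, ht, h⟩ := ih (2 * a + 5)
    have h' := absorb a ((blocks k x).cons 1)
    rw [ones_cons] at h'
    refine ⟨_, b, ?_, ?_, h'.trans h⟩
    · rw [hb]; ring
    · push_cast at ht ⊢
      rw [mul_add, ht]
      ring

/-- All runs of ones merge into a single one. -/
theorem merge_blocks (k a : ℕ) :
    ∃ t n : ℕ, n + 8 = 4 * (a + 5) * 2 ^ k ∧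
      (3 * t : ℤ) = 32 * (a + 5) ^ 2 * 4 ^ k - 2 * (a + 5) ^ 2 - 144 * (a + 5) * 2 ^ k
        + 39 * (a + 5) + 69 * k + 111 ∧
      Steps t (some 1) blank
        ((ones a (blocks k ((((blank.cons 1).cons 0).cons 1).cons 0))).cons 0)
        (some 1) (ones n blank) blank := by
  obtain ⟨t, b, hb, ht, h⟩ := absorb_blocks k a ((((blank.cons 1).cons 0).cons 1).cons 0)
  have hs (m : ℕ) := sweep_right m blank blank
  simp only [cons_zero_blank] at hs
  refine ⟨_, _, ?_, ?_, ((h.trans (absorb b _)).trans (absorb _ _)).trans (hs _)⟩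
  · rw [mul_assoc, ← hb]; ring
  · have hb' : (b : ℤ) = (a + 5) * 2 ^ k - 5 := by
      rw [eq_sub_iff_add_eq]; exact_mod_cast hb
    have h4 : (4 : ℤ) ^ k = (2 ^ k) ^ 2 := by
      rw [← pow_mul, mul_comm, pow_mul]; norm_num
    rw [h4] at ht ⊢
    push_cast
    rw [hb']
    linear_combination ht

/-- Three ones to the left of the head become `110`. -/
theorem erode (k : ℕ) (l x : HalfTape) (c : Fin 2) :
    ∃ l' c', l'.cons c' = ones (3 * k) (l.cons c) ∧
      Steps (3 * k) (some 4) l' (x.cons c') (some 4) l ((revBlocks k x).cons c) := by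
  induction k generalizing x with
  | zero => exact ⟨l, c, rfl, .refl _ _ _⟩
  | succ k ih =>
    obtain ⟨l', c', e, h⟩ := ih (((x.cons 0).cons 1).cons 1)
    rw [revBlocks_cons] at h
    exact ⟨((l'.cons c').cons 1).cons 1, 1, by rw [e]; rfl,
      .left rfl (.left rfl (.left rfl h))⟩

theorem start_erode (k : ℕ) (l : HalfTape) (c : Fin 2) :
    Steps (3 * k + 5) (some 1) (ones (3 * k) (l.cons c)) blank
      (some 4) l ((revBlocks k (((blank.cons 1).cons 0).cons 1)).cons c) := by
  obtain ⟨l', c', e, h⟩ := erode k l (((blank.cons 1).cons 0).cons 1) c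
  have h' : Steps (3 * k + 5) (some 1) (l'.cons c') (((blank.cons 0).cons 0).cons 0)
      (some 4) l ((revBlocks k (((blank.cons 1).cons 0).cons 1)).cons c) :=
    .right rfl (.right rfl (.left rfl (.left rfl (.left rfl h))))
  rwa [e, cons_zero_blank, cons_zero_blank, cons_zero_blank] at h'

theorem run_zero_mod_three (k : ℕ) :
    ∃ t n : ℕ, n + 8 = 36 * 2 ^ k ∧
      t + 432 * 2 ^ k = 864 * 4 ^ k + 26 * k + 112 ∧
      Steps t (some 1) (ones (3 * (k + 1)) blank) blank
        (some 1) (ones n blank) blank := by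
  obtain ⟨t, n, hn, ht, h⟩ := merge_blocks k 4
  rw [← cons_zero_revBlocks] at h
  have h' := start_erode (k + 1) blank 0
  rw [cons_zero_blank] at h'
  refine ⟨_, n, by omega, ?_, h'.trans (.leftBlank rfl (.right rfl (.left rfl (.leftBlank rfl h))))⟩
  zify
  push_cast at ht ⊢
  linarith

theorem run_one_mod_three (k : ℕ) :
    ∃ t n : ℕ, n + 8 = 32 * 2 ^ k ∧
      3 * t + 1152 * 2 ^ k = 2048 * 4 ^ k + 78 * k + 328 ∧
      Steps t (some 1) (ones (3 * k + 1) blank) blank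
        (some 1) (ones n blank) blank := by
  obtain ⟨t, n, hn, ht, h⟩ := merge_blocks k 3
  rw [← cons_zero_revBlocks] at h
  have h' := start_erode k blank 1
  rw [ones_cons] at h'
  refine ⟨_, n, by omega, ?_, h'.trans (.leftBlank rfl (.leftBlank rfl
    (.leftBlank rfl (.right rfl (.left rfl (.leftBlank rfl h))))))⟩
  zify
  push_cast at ht ⊢
  linarith

theorem run_two_mod_three (k : ℕ) :
    Steps (3 * k + 7) (some 1) (ones (3 * k + 2) blank) blank (some 5) blank
      ((((revBlocks k (((blank.cons 1).cons 0).cons 1)).cons 0).cons 1).cons 0) := by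
  have h := start_erode k (blank.cons 1) 1
  rw [ones_cons, ones_cons] at h
  exact h.trans (.left rfl (.leftBlank rfl (.refl _ _ _)))

set_option exponentiation.threshold 2000 in
theorem run_to_halt : ∃ t k : ℕ, 3 * k + 10 = 2 ^ 1538 ∧
    t + 1 = 2048 * (4 ^ 1533 - 1) / 3 - 11 * 2 ^ 1538 + 14141831 ∧
    Steps t (some 0) blank blank (some 5) blank
      ((((revBlocks k (((blank.cons 1).cons 0).cons 1)).cons 0).cons 1).cons 0) := by
  have h₀ : Steps 1 (some 0) blank (blank.cons 0) (some 1) (ones 1 blank) blank :=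
    .right rfl (.refl _ _ _)
  rw [cons_zero_blank] at h₀
  obtain ⟨t₁, n₁, hn₁, ht₁, h₁⟩ := run_one_mod_three 0
  obtain rfl : n₁ = 3 * (7 + 1) := by omega
  obtain ⟨t₂, n₂, hn₂, ht₂, h₂⟩ := run_zero_mod_three 7
  obtain rfl : n₂ = 3 * 1533 + 1 := by omega
  obtain ⟨t₃, n₃, hn₃, ht₃, h₃⟩ := run_one_mod_three 1533
  have hmod : 2 ^ 1538 % 3 = 1 := by norm_num
  have hmod' : 4 ^ 1533 % 3 = 1 := by norm_num
  have hpow : 2 ^ 1538 = 32 * 2 ^ 1533 := by norm_num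
  have hle : 2 ^ 1533 ≤ 4 ^ 1533 := by norm_num
  have hlt : 1533 < 2 ^ 1533 := by norm_num
  norm_num only at ht₁ ht₂
  generalize 2 ^ 1538 = z at *
  generalize 2 ^ 1533 = y at *
  generalize 4 ^ 1533 = x at *
  obtain ⟨k, rfl⟩ : ∃ k, n₃ = 3 * k + 2 := ⟨n₃ / 3, by omega⟩
  exact ⟨_, k, by omega, by omega,
    (((h₀.trans h₁).trans h₂).trans h₃).trans (run_two_mod_three k)⟩

/-- The number of non-blank cells of a tape. -/
noncomputable def weight (T : Tape (Fin 2)) : ℕ∞ := {i : ℤ | T.nth i ≠ 0}.encard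

theorem weight_move (T : Tape (Fin 2)) : weight (T.move .right) = weight T := by
  have h : {i : ℤ | (T.move .right).nth i ≠ 0} = (· + 1) ⁻¹' {i : ℤ | T.nth i ≠ 0} := by
    ext i; simp [Tape.move_right_nth]
  rw [weight, h]
  exact Set.encard_preimage_of_bijective (Equiv.addRight (1 : ℤ)).bijective _

theorem weight_cons_left (a : Fin 2) (l r : HalfTape) :
    weight (Tape.mk' (l.cons a) r) = weight (Tape.mk' l (r.cons a)) := by
  rw [← weight_move (Tape.mk' l (r.cons a))]
  simp

theorem weight_cons_zero (r : HalfTape) :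
    weight (Tape.mk' blank (r.cons 0)) = weight (Tape.mk' blank r) := by
  rw [← weight_cons_left, cons_zero_blank]

theorem weight_cons_one (r : HalfTape) :
    weight (Tape.mk' blank (r.cons 1)) = weight (Tape.mk' blank r) + 1 := by
  rw [← weight_cons_zero r, weight, weight]
  have hw : Tape.mk' blank (r.cons 1) = (Tape.mk' blank (r.cons 0)).write 1 := by simp
  rw [hw, ← Set.encard_insert_of_notMem (a := (0 : ℤ)) (by simp)]
  congr 1
  ext i
  by_cases hi : i = 0 <;> simp [hi, Tape.write_nth, -Tape.write_mk']

theorem weight_blank : weight (Tape.mk' blank blank) = 0 := by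
  rw [weight, Set.encard_eq_zero, Set.eq_empty_iff_forall_notMem]
  intro i
  have h : (Tape.mk' blank blank).nth i = 0 := by
    rcases i with (_ | n) | n <;> rfl
  simp [h]

theorem weight_revBlocks (k : ℕ) (r : HalfTape) :
    weight (Tape.mk' blank (revBlocks k r)) = weight (Tape.mk' blank r) + 2 * k := by
  induction k with
  | zero => simp [revBlocks]
  | succ k ih =>
    rw [revBlocks, weight_cons_one, weight_cons_one, weight_cons_zero, ih]
    push_cast
    ring

theorem sigmaCount_conf (q : Option (Fin 6)) (l r : HalfTape) (p : ℤ) :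
    sigmaCount (conf q l r p) = (weight (Tape.mk' l r)).toNat := by
  rw [weight, ← Set.encard_preimage_of_bijective (Equiv.subRight p).bijective]
  rfl

theorem step_iterate_of_halted {c : Cfg 6 2} (hc : c.state = none) (t : ℕ) :
    (step M)^[t] c = c :=
  Function.iterate_fixed (by simp [step, hc]) t

theorem init_eq_conf : init 6 2 = conf (some 0) blank blank 0 := by
  simp only [init, conf]
  congr 1
  funext i
  rcases i with (_ | n) | n <;> rfl

/-- Started on the all-blank tape, Marxen and Buntrock's second machine halts after
exactly `2048·(4^1533 - 1)/3 - 11·2^1538 + 14,141,831` steps, leaving exactly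
`2·(2^1538 - 10)/3 + 4` non-blank cells on the final tape. -/
theorem marxen_buntrock_second_halts :
    HaltsIn M (init 6 2) (2048 * (4 ^ 1533 - 1) / 3 - 11 * 2 ^ 1538 + 14141831) ∧
    sigmaCount ((step M)^[2048 * (4 ^ 1533 - 1) / 3 - 11 * 2 ^ 1538 + 14141831]
        (init 6 2)) = 2 * ((2 ^ 1538 - 10) / 3) + 4 := by
  obtain ⟨t, k, hk, ht, h⟩ := run_to_halt
  rw [← ht, ← hk]
  obtain ⟨p, hp⟩ := h 0
  rw [← init_eq_conf] at hp
  obtain ⟨p', hlast⟩ := (h.trans (.right rfl (.refl _ _ _))) 0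
  rw [← init_eq_conf] at hlast
  refine ⟨⟨by rw [hlast, conf], fun i hi hnone => ?_⟩, ?_⟩
  · obtain ⟨j, rfl⟩ := Nat.exists_eq_add_of_le (Nat.le_of_lt_succ hi)
    rw [add_comm, Function.iterate_add_apply, step_iterate_of_halted hnone] at hp
    rw [hp] at hnone
    cases hnone
  · rw [hlast, sigmaCount_conf, weight_cons_left, weight_cons_one, weight_cons_one,
      weight_cons_zero, weight_revBlocks, weight_cons_one, weight_cons_zero, weight_cons_one,
      weight_blank, Nat.add_sub_cancel, Nat.mul_div_cancel_left k (by norm_num)]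
    have hw : (0 + 1 + 1 + 2 * k + 1 + 1 : ℕ∞) = ((2 * k + 4 : ℕ) : ℕ∞) := by
      push_cast
      ring
    rw [hw, ENat.toNat_natCast]
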